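/- In the data-market game with bounded effort (ℰ_s = [0, e_s^max] with 0 < e_s^max < ∞, 𝒂̄_s := min{a > 0 : μ_s(a) = e_s^max}, and 𝒜_s = [𝒂̲_s, 𝒂̄_s] for every s), suppose γ_i^j > 0 for all i ∈ {1,…,N} and j ∈ {1,…,M}, and 𝒂̲_s ≤ 𝛄_s < 𝒂̄_s for every s. Then there exists a generalized Nash equilibrium (c,a) whose induced effort profile (μ_s(𝒂_s))_{s=1}^N has price of anarchy equal to 1 (i.e., minimizes the ex-ante social cost 𝓛(e) = Σ_s 𝛄_s·σ_s(e_s)² + Σ_s e_s over ℰ = ℰ_1 × … × ℰ_N) if and only if ξ_{i,l}^j = 0 for every j ∈ {1,…,M} and every i, l ∈ {1,…,N} with i ≠ l. -/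

import Mathlib

/-- The (within-`[0,∞)`) derivative of `σ`. -/
noncomputable def sigd (σ : ℝ → ℝ) : ℝ → ℝ := derivWithin σ (Set.Ici 0)

/-- `𝒂̲ = -1/(2 σ(0) σ'(0))`. -/
noncomputable def alow (σ : ℝ → ℝ) : ℝ := -1 / (2 * σ 0 * sigd σ 0)

/-- Assumption 3 of the paper: `σ` is positive, strictly decreasing, convex and C² on `[0,∞)`. -/
def SigmaOK (σ : ℝ → ℝ) : Prop :=
  (∀ e ∈ Set.Ici (0:ℝ), 0 < σ e) ∧ StrictAntiOn σ (Set.Ici 0) ∧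
    ConvexOn ℝ (Set.Ici 0) σ ∧ ContDiffOn ℝ 2 σ (Set.Ici 0)

/-- `m` is the unique maximizer of `f` on `S`. -/
def UniqueMaxOn (f : ℝ → ℝ) (S : Set ℝ) (m : ℝ) : Prop :=
  m ∈ S ∧ (∀ e ∈ S, f e ≤ f m) ∧ ∀ e ∈ S, (∀ e' ∈ S, f e' ≤ f e) → e = m

variable {N M : ℕ}

/-- `𝒂_s = Σ_j a_s^j`, the total quadratic-penalty weight offered to source `s`. -/
noncomputable def boldA (a : Fin M → Fin N → ℝ) (s : Fin N) : ℝ := ∑ j, a j s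

/-- `σ_i(μ_i(𝒂_i))²`, the equilibrium variance of source `i`'s data. -/
noncomputable def Vval (σ μ : Fin N → ℝ → ℝ) (a : Fin M → Fin N → ℝ) (i : Fin N) : ℝ :=
  σ i (μ i (boldA a i)) ^ 2

/-- `q_s^b(a) = a_s^b Σ_i ξ_{s,i}^b σ_i(μ_i(𝒂_i))²`. -/
noncomputable def qb (σ μ : Fin N → ℝ → ℝ) (ξ : Fin M → Fin N → Fin N → ℝ)
    (a : Fin M → Fin N → ℝ) (b : Fin M) (s : Fin N) : ℝ :=
  a b s * ∑ i, ξ b s i * Vval σ μ a i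

/-- `q_s(a) = Σ_j q_s^j(a) + μ_s(𝒂_s)`. -/
noncomputable def qtot (σ μ : Fin N → ℝ → ℝ) (ξ : Fin M → Fin N → Fin N → ℝ)
    (a : Fin M → Fin N → ℝ) (s : Fin N) : ℝ :=
  (∑ j, qb σ μ ξ a j s) + μ s (boldA a s)

/-- Aggregator `b`'s loss `L^b`. -/
noncomputable def Lagg (σ μ : Fin N → ℝ → ℝ) (ξ : Fin M → Fin N → Fin N → ℝ)
    (γ : Fin M → Fin N → ℝ) (c a : Fin M → Fin N → ℝ) (b : Fin M) : ℝ :=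
  (∑ i, γ b i * Vval σ μ a i) +
    ∑ i, (c b i - a b i * ∑ l, ξ b i l * Vval σ μ a l)

/-- Feasibility of `(c^b, a^b)` for aggregator `b` within the profile `(c,a)`:
nonnegative weights, `𝒂_s ∈ 𝒜_s`, individual rationality and nonnegative expected payments. -/
def Feasible (σ μ : Fin N → ℝ → ℝ) (ξ : Fin M → Fin N → Fin N → ℝ)
    (𝒜 : Fin N → Set ℝ) (c a : Fin M → Fin N → ℝ) (b : Fin M) : Prop :=
  ∀ s, 0 ≤ a b s ∧ boldA a s ∈ 𝒜 s ∧
    μ s (boldA a s) ≤ (∑ j, c j s) - ∑ j, qb σ μ ξ a j s ∧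
    0 ≤ c b s - qb σ μ ξ a b s

/-- Generalized Nash equilibrium of the game between the aggregators. -/
def IsGNE (σ μ : Fin N → ℝ → ℝ) (ξ : Fin M → Fin N → Fin N → ℝ)
    (γ : Fin M → Fin N → ℝ) (𝒜 : Fin N → Set ℝ) (c a : Fin M → Fin N → ℝ) : Prop :=
  (∀ b, Feasible σ μ ξ 𝒜 c a b) ∧
    ∀ b (c' a' : Fin N → ℝ),
      Feasible σ μ ξ 𝒜 (Function.update c b c') (Function.update a b a') b →
      Lagg σ μ ξ γ c a b ≤ Lagg σ μ ξ γ (Function.update c b c') (Function.update a b a') b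

/-- The ex-ante social cost `𝓛(e) = Σ_s 𝛄_s σ_s(e_s)² + Σ_s e_s`. -/
noncomputable def SC (Γ : Fin N → ℝ) (σ : Fin N → ℝ → ℝ) (e : Fin N → ℝ) : ℝ :=
  (∑ s, Γ s * σ s (e s) ^ 2) + ∑ s, e s

namespace SigmaOK

variable {σ : ℝ → ℝ}

theorem hasDerivWithinAt (h : SigmaOK σ) {e : ℝ} (he : 0 ≤ e) :
    HasDerivWithinAt σ (sigd σ e) (Set.Ici 0) e :=
  ((h.2.2.2.differentiableOn (by norm_num)) e he).hasDerivWithinAt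

theorem tangent_le (h : SigmaOK σ) {e x : ℝ} (he : 0 ≤ e) (hx : 0 ≤ x) :
    σ e + sigd σ e * (x - e) ≤ σ x := by
  rcases lt_trichotomy e x with hlt | rfl | hlt
  · have := h.2.2.1.le_slope_of_hasDerivWithinAt he hx hlt (h.hasDerivWithinAt he)
    rw [slope_def_field, le_div_iff₀ (sub_pos.2 hlt)] at this
    linarith
  · simp
  · have := h.2.2.1.slope_le_of_hasDerivWithinAt hx he hlt (h.hasDerivWithinAt he)
    rw [slope_def_field, div_le_iff₀ (sub_pos.2 hlt)] at this
    linarith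

theorem sigd_neg (h : SigmaOK σ) {e : ℝ} (he : 0 ≤ e) : sigd σ e < 0 := by
  have he' : 0 ≤ e + 1 := by linarith
  have h₁ := h.tangent_le he he'
  have h₂ : σ (e + 1) < σ e := h.2.1 he he' (by linarith)
  linarith

theorem mul_sigd_neg (h : SigmaOK σ) {e : ℝ} (he : 0 ≤ e) : σ e * sigd σ e < 0 :=
  mul_neg_of_pos_of_neg (h.1 e he) (h.sigd_neg he)

theorem mul_sigd_mono (h : SigmaOK σ) {e x : ℝ} (he : 0 ≤ e) (hex : e ≤ x) :
    σ e * sigd σ e ≤ σ x * sigd σ x := by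
  have hx : 0 ≤ x := he.trans hex
  rcases hex.eq_or_lt with rfl | hlt
  · exact le_rfl
  have h₁ := h.tangent_le he hx
  have h₂ := h.tangent_le hx he
  have h₃ : sigd σ e ≤ sigd σ x := by
    by_contra! hcon
    nlinarith [mul_pos (sub_pos.2 hcon) (sub_pos.2 hlt)]
  have h₄ : σ x < σ e := h.2.1 he hx hlt
  nlinarith [h.1 x hx, h.1 e he, h.sigd_neg hx]

theorem sq_tangent_le (h : SigmaOK σ) {e x : ℝ} (he : 0 ≤ e) (hx : 0 ≤ x) :
    σ e ^ 2 + 2 * (σ e * sigd σ e) * (x - e) ≤ σ x ^ 2 := by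
  have h₁ := mul_le_mul_of_nonneg_left (h.tangent_le he hx) (h.1 e he).le
  nlinarith [sq_nonneg (σ x - σ e)]

theorem hasDerivWithinAt_sq (h : SigmaOK σ) {e : ℝ} (he : 0 ≤ e) :
    HasDerivWithinAt (fun x => σ x ^ 2) (2 * (σ e * sigd σ e)) (Set.Ici 0) e := by
  refine ((h.hasDerivWithinAt he).fun_pow 2).congr_deriv ?_
  push_cast
  ring

theorem alow_pos (h : SigmaOK σ) : 0 < alow σ := by
  have := h.mul_sigd_neg le_rfl
  unfold alow
  exact div_pos_of_neg_of_neg (by norm_num) (by linarith)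

end SigmaOK

/-- The total weight under which effort `e` satisfies the first-order condition of a source. -/
noncomputable def inducingWeight (σ : ℝ → ℝ) (e : ℝ) : ℝ := -1 / (2 * (σ e * sigd σ e))

/-- The reduction of the variance when effort `e` is raised by `t`. -/
def varianceDrop (σ : ℝ → ℝ) (e t : ℝ) : ℝ := σ e ^ 2 - σ (e + t) ^ 2

theorem varianceDrop_zero (σ : ℝ → ℝ) (e : ℝ) : varianceDrop σ e 0 = 0 := by
  simp [varianceDrop]

section Source

variable {σ μ : ℝ → ℝ} {emax : ℝ}

theorem inducingWeight_pos (h : SigmaOK σ) {e : ℝ} (he : 0 ≤ e) : 0 < inducingWeight σ e :=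
  div_pos_of_neg_of_neg (by norm_num) (by linarith [h.mul_sigd_neg he])

theorem inducingWeight_mul (h : SigmaOK σ) {e : ℝ} (he : 0 ≤ e) :
    inducingWeight σ e * (2 * (σ e * sigd σ e)) = -1 :=
  div_mul_cancel₀ _ (by linarith [h.mul_sigd_neg he] : 2 * (σ e * sigd σ e) < 0).ne

theorem inducingWeight_zero (σ : ℝ → ℝ) : inducingWeight σ 0 = alow σ := by
  simp [inducingWeight, alow, mul_assoc]

theorem inducingWeight_le_of_mul_le (h : SigmaOK σ) {a e : ℝ} (he : 0 ≤ e)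
    (ha : a * (2 * (σ e * sigd σ e)) ≤ -1) : inducingWeight σ e ≤ a := by
  have h₁ := inducingWeight_mul h he
  have h₂ := h.mul_sigd_neg he
  by_contra! hcon
  nlinarith

theorem inducingWeight_mono (h : SigmaOK σ) {e x : ℝ} (he : 0 ≤ e) (hex : e ≤ x) :
    inducingWeight σ e ≤ inducingWeight σ x := by
  have hx := he.trans hex
  refine inducingWeight_le_of_mul_le h he ?_
  rw [← inducingWeight_mul h hx]
  have := h.mul_sigd_mono he hex
  exact mul_le_mul_of_nonneg_left (by linarith) (inducingWeight_pos h hx).le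

theorem eq_of_mul_eq_neg_one (h : SigmaOK σ) {e a : ℝ} (he : 0 ≤ e)
    (ha : a * (2 * (σ e * sigd σ e)) = -1) : a = inducingWeight σ e := by
  have := h.mul_sigd_neg he
  exact eq_div_of_mul_eq (by linarith : 2 * (σ e * sigd σ e) < 0).ne ha

theorem maximizer_inducingWeight (h : SigmaOK σ)
    (hμ : ∀ a : ℝ, 0 < a → UniqueMaxOn (fun e => -a * σ e ^ 2 - e) (Set.Icc 0 emax) (μ a))
    {e : ℝ} (he : e ∈ Set.Icc 0 emax) : μ (inducingWeight σ e) = e := by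
  have hpos := inducingWeight_pos h he.1
  refine ((hμ _ hpos).2.2 e he fun x hx => ?_).symm
  have h₁ := mul_le_mul_of_nonneg_left (h.sq_tangent_le he.1 hx.1) hpos.le
  have h₂ := inducingWeight_mul h he.1
  have h₃ : inducingWeight σ e * (σ e ^ 2 + 2 * (σ e * sigd σ e) * (x - e)) =
      inducingWeight σ e * σ e ^ 2 - (x - e) := by
    linear_combination (x - e) * h₂
  linarith

theorem variational_inequality (h : SigmaOK σ)
    (hμ : ∀ a : ℝ, 0 < a → UniqueMaxOn (fun e => -a * σ e ^ 2 - e) (Set.Icc 0 emax) (μ a))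
    {a : ℝ} (ha : 0 < a) {y : ℝ} (hy : y ∈ Set.Icc 0 emax) :
    0 ≤ (a * (2 * (σ (μ a) * sigd σ (μ a))) + 1) * (y - μ a) := by
  obtain ⟨hmem, hmax, -⟩ := hμ a ha
  have hd : HasDerivWithinAt (fun x => a * σ x ^ 2 + x)
      (a * (2 * (σ (μ a) * sigd σ (μ a))) + 1) (Set.Icc 0 emax) (μ a) :=
    (((h.hasDerivWithinAt_sq hmem.1).const_mul a).add (hasDerivWithinAt_id _ _)).mono
      Set.Icc_subset_Ici_self
  have hmin : IsMinOn (fun x => a * σ x ^ 2 + x) (Set.Icc 0 emax) (μ a) := fun x hx => by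
    have := hmax x hx
    simp only [Set.mem_ofPred_eq]
    linarith
  have := hmin.localize.hasFDerivWithinAt_nonneg hd.hasFDerivWithinAt
    (sub_mem_posTangentConeAt_of_segment_subset
      ((convex_Icc (0 : ℝ) emax).segment_subset hmem hy))
  simpa [mul_comm] using this

theorem eq_inducingWeight (h : SigmaOK σ)
    (hμ : ∀ a : ℝ, 0 < a → UniqueMaxOn (fun e => -a * σ e ^ 2 - e) (Set.Icc 0 emax) (μ a))
    {a : ℝ} (ha : alow σ ≤ a) (hlt : μ a < emax) : a = inducingWeight σ (μ a) := by
  have hapos := h.alow_pos.trans_le ha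
  have hmem := (hμ a hapos).1
  have hmax : (0 : ℝ) ≤ emax := hmem.1.trans hmem.2
  refine eq_of_mul_eq_neg_one h hmem.1 (le_antisymm ?_ ?_)
  · rcases hmem.1.eq_or_lt with h0 | h0
    · rw [← h0, ← inducingWeight_mul h le_rfl, inducingWeight_zero]
      have := h.mul_sigd_neg le_rfl
      nlinarith
    · have := variational_inequality h hμ hapos (y := 0) ⟨le_rfl, hmax⟩
      nlinarith
  · have := variational_inequality h hμ hapos (y := emax) ⟨hmax, le_rfl⟩
    have := nonneg_of_mul_nonneg_left this (sub_pos.2 hlt)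
    linarith

theorem inducingWeight_le_of_maximizer_eq (h : SigmaOK σ) (hemax : 0 < emax)
    (hμ : ∀ a : ℝ, 0 < a → UniqueMaxOn (fun e => -a * σ e ^ 2 - e) (Set.Icc 0 emax) (μ a))
    {a : ℝ} (ha : 0 < a) (hmax : μ a = emax) : inducingWeight σ emax ≤ a := by
  have := variational_inequality h hμ ha (y := 0) ⟨le_rfl, hemax.le⟩
  rw [hmax] at this
  exact inducingWeight_le_of_mul_le h hemax.le (by nlinarith)

theorem varianceDrop_nonneg (h : SigmaOK σ) {e t : ℝ} (he : 0 ≤ e) (ht : 0 ≤ t) :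
    0 ≤ varianceDrop σ e t := by
  have h₁ : σ (e + t) ≤ σ e := h.2.1.antitoneOn he (add_nonneg he ht) (by linarith)
  have h₂ := h.1 (e + t) (add_nonneg he ht)
  unfold varianceDrop
  nlinarith

theorem inducingWeight_mul_varianceDrop_le (h : SigmaOK σ) {e t : ℝ} (he : 0 ≤ e) (ht : 0 ≤ t) :
    inducingWeight σ e * varianceDrop σ e t ≤ t := by
  have h₁ := mul_le_mul_of_nonneg_left (h.sq_tangent_le he (add_nonneg he ht))
    (inducingWeight_pos h he).le
  have h₂ := inducingWeight_mul h he
  unfold varianceDrop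
  linear_combination h₁ - t * h₂

open Filter Topology in
theorem tendsto_varianceDrop_div (h : SigmaOK σ) {e r : ℝ} (he : 0 ≤ e) (hr : 0 < r) :
    Tendsto (fun t => varianceDrop σ e (r * t) / t) (𝓝[>] 0) (𝓝 (r / inducingWeight σ e)) := by
  have hmaps : Tendsto (fun t : ℝ => e + r * t) (𝓝[>] 0) (𝓝[Set.Ici 0 \ {e}] e) := by
    refine tendsto_nhdsWithin_iff.2 ⟨?_, ?_⟩
    · have : Tendsto (fun t : ℝ => e + r * t) (𝓝 0) (𝓝 (e + r * 0)) :=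
        Continuous.tendsto (by fun_prop) 0
      simpa using this.mono_left nhdsWithin_le_nhds
    · filter_upwards [self_mem_nhdsWithin] with t ht
      have := mul_pos hr ht
      exact ⟨by simp only [Set.mem_Ici]; linarith,
        by simp only [Set.mem_singleton_iff]; linarith⟩
  have hlim := ((hasDerivWithinAt_iff_tendsto_slope.1 (h.hasDerivWithinAt_sq he)).comp
    hmaps).const_mul (-r)
  have hval : -r * (2 * (σ e * sigd σ e)) = r / inducingWeight σ e := by
    rw [eq_div_iff (inducingWeight_pos h he).ne']
    linear_combination (-r) * inducingWeight_mul h he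
  rw [hval] at hlim
  refine hlim.congr' ?_
  filter_upwards [self_mem_nhdsWithin] with t ht
  have ht' : t ≠ 0 := (Set.mem_Ioi.1 ht).ne'
  simp only [Function.comp, slope_def_field, varianceDrop]
  field_simp
  ring

end Source

section Game

variable {σ μ : Fin N → ℝ → ℝ} {ξ : Fin M → Fin N → Fin N → ℝ} {γ : Fin M → Fin N → ℝ}

theorem boldA_update (a : Fin M → Fin N → ℝ) (b : Fin M) (x : Fin N → ℝ) (s : Fin N) :
    boldA (Function.update a b x) s = boldA a s - a b s + x s := by
  unfold boldA
  rw [← Finset.add_sum_erase _ _ (Finset.mem_univ b),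
    ← Finset.add_sum_erase _ (fun j => a j s) (Finset.mem_univ b)]
  have : ∑ j ∈ Finset.univ.erase b, Function.update a b x j s =
      ∑ j ∈ Finset.univ.erase b, a j s :=
    Finset.sum_congr rfl fun j hj => by rw [Function.update_of_ne (Finset.ne_of_mem_erase hj)]
  rw [this, Function.update_self]
  ring

/-- In an equilibrium no aggregator gains by raising the total weights to `A`, provided its extra
payments `δ` cover the additional effort and the change in the payments of the others. -/
theorem IsGNE.no_gain_of_raise {𝒜 : Fin N → Set ℝ} {c a : Fin M → Fin N → ℝ}
    (hG : IsGNE σ μ ξ γ 𝒜 c a) (b : Fin M) {A δ : Fin N → ℝ}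
    (hA : ∀ s, A s ∈ 𝒜 s) (hle : ∀ s, boldA a s ≤ A s) (hδ : ∀ s, 0 ≤ δ s)
    (hcover : ∀ s, μ s (A s) - μ s (boldA a s) ≤ δ s + ∑ j ∈ Finset.univ.erase b,
      a j s * ∑ l, ξ j s l * (Vval σ μ a l - σ l (μ l (A l)) ^ 2)) :
    ∑ s, γ b s * (Vval σ μ a s - σ s (μ s (A s)) ^ 2) ≤ ∑ s, δ s := by
  set x : Fin N → ℝ := fun s => a b s + (A s - boldA a s) with hx
  set y : Fin N → ℝ := fun s =>
    x s * (∑ l, ξ b s l * σ l (μ l (A l)) ^ 2) + (c b s - qb σ μ ξ a b s) + δ s with hy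
  have hbold : ∀ s, boldA (Function.update a b x) s = A s := fun s => by
    rw [boldA_update, hx]; ring
  have hV : ∀ s, Vval σ μ (Function.update a b x) s = σ s (μ s (A s)) ^ 2 := fun s => by
    rw [Vval, hbold]
  have hself : ∀ s, Function.update c b y b s - qb σ μ ξ (Function.update a b x) b s =
      c b s - qb σ μ ξ a b s + δ s := fun s => by
    simp only [qb, Function.update_self, hV, hy]; ring
  have hother : ∀ s, ∀ j ∈ Finset.univ.erase b,
      Function.update c b y j s - qb σ μ ξ (Function.update a b x) j s =
      (c j s - qb σ μ ξ a j s) +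
        a j s * ∑ l, ξ j s l * (Vval σ μ a l - σ l (μ l (A l)) ^ 2) := fun s j hj => by
    have hne := Finset.ne_of_mem_erase hj
    simp only [qb, Function.update_of_ne hne, hV, mul_sub, Finset.sum_sub_distrib]
    ring
  have hfeas : Feasible σ μ ξ 𝒜 (Function.update c b y) (Function.update a b x) b := by
    intro s
    obtain ⟨h0, -, hIR, hnn⟩ := hG.1 b s
    refine ⟨?_, ?_, ?_, ?_⟩
    · rw [Function.update_self]
      linarith [hle s]
    · rw [hbold]; exact hA s
    · rw [hbold, ← Finset.sum_sub_distrib, ← Finset.add_sum_erase _ _ (Finset.mem_univ b),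
        hself, Finset.sum_congr rfl (hother s), Finset.sum_add_distrib]
      rw [← Finset.sum_sub_distrib, ← Finset.add_sum_erase _ _ (Finset.mem_univ b)] at hIR
      linarith [hcover s]
    · rw [hself]; exact add_nonneg hnn (hδ s)
  have key := hG.2 b y x hfeas
  have hpay : ∑ s, (Function.update c b y b s - Function.update a b x b s *
      ∑ l, ξ b s l * Vval σ μ (Function.update a b x) l) =
      ∑ s, (c b s - a b s * ∑ l, ξ b s l * Vval σ μ a l) + ∑ s, δ s := by
    rw [← Finset.sum_add_distrib]
    exact Finset.sum_congr rfl fun s _ => hself s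
  unfold Lagg at key
  rw [hpay] at key
  simp only [hV] at key
  simp only [mul_sub, Finset.sum_sub_distrib]
  linarith

variable {emax aubar : Fin N → ℝ} {c a : Fin M → Fin N → ℝ} {e : Fin N → ℝ}

theorem sum_erase_boldA (a : Fin M → Fin N → ℝ) (b : Fin M) (s : Fin N) :
    ∑ j ∈ Finset.univ.erase b, a j s = boldA a s - a b s := by
  rw [boldA, ← Finset.add_sum_erase _ _ (Finset.mem_univ b)]
  ring

/-- `IsGNE.no_gain_of_raise` in terms of the increments `T` of the induced efforts. -/
theorem IsGNE.no_gain_of_effort_raise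
    (hG : IsGNE σ μ ξ γ (fun s => Set.Icc (alow (σ s)) (aubar s)) c a)
    (hσ : ∀ s, SigmaOK (σ s))
    (hμ : ∀ s, ∀ a : ℝ, 0 < a →
      UniqueMaxOn (fun e => -a * σ s e ^ 2 - e) (Set.Icc 0 (emax s)) (μ s a))
    (hemax : ∀ s, inducingWeight (σ s) (emax s) ≤ aubar s)
    (he0 : ∀ s, 0 ≤ e s) (he : ∀ s, boldA a s = inducingWeight (σ s) (e s))
    (b : Fin M) {T δ : Fin N → ℝ} (hT : ∀ s, 0 ≤ T s) (hTmax : ∀ s, e s + T s ≤ emax s)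
    (hδ : ∀ s, 0 ≤ δ s)
    (hcover : ∀ s, T s ≤ δ s + ∑ j ∈ Finset.univ.erase b,
      a j s * ∑ l, ξ j s l * varianceDrop (σ l) (e l) (T l)) :
    ∑ s, γ b s * varianceDrop (σ s) (e s) (T s) ≤ ∑ s, δ s := by
  have hnn : ∀ s, 0 ≤ e s + T s := fun s => add_nonneg (he0 s) (hT s)
  have hraise : ∀ s, μ s (inducingWeight (σ s) (e s + T s)) = e s + T s := fun s =>
    maximizer_inducingWeight (hσ s) (hμ s) ⟨hnn s, hTmax s⟩
  have hbase : ∀ s, μ s (boldA a s) = e s := fun s => by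
    rw [he]
    exact maximizer_inducingWeight (hσ s) (hμ s)
      ⟨he0 s, (le_add_of_nonneg_right (hT s)).trans (hTmax s)⟩
  have key := hG.no_gain_of_raise b (A := fun s => inducingWeight (σ s) (e s + T s)) (δ := δ)
    (fun s => ⟨by
      rw [← inducingWeight_zero]
      exact inducingWeight_mono (hσ s) le_rfl (hnn s),
      (inducingWeight_mono (hσ s) (hnn s) (hTmax s)).trans (hemax s)⟩)
    (fun s => by
      rw [he]
      exact inducingWeight_mono (hσ s) (he0 s) (le_add_of_nonneg_right (hT s)))
    hδ (fun s => by
      simpa only [Vval, hbase, hraise, add_sub_cancel_left, varianceDrop] using hcover s)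
  simpa only [Vval, hbase, hraise, varianceDrop] using key

open Filter Topology in
/-- In an equilibrium with interior efforts every weight is at least the demand. -/
theorem IsGNE.demand_le_weight
    (hG : IsGNE σ μ ξ γ (fun s => Set.Icc (alow (σ s)) (aubar s)) c a)
    (hσ : ∀ s, SigmaOK (σ s))
    (hμ : ∀ s, ∀ a : ℝ, 0 < a →
      UniqueMaxOn (fun e => -a * σ s e ^ 2 - e) (Set.Icc 0 (emax s)) (μ s a))
    (hemax : ∀ s, inducingWeight (σ s) (emax s) ≤ aubar s)
    (he0 : ∀ s, 0 ≤ e s) (he : ∀ s, boldA a s = inducingWeight (σ s) (e s))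
    (helt : ∀ s, e s < emax s)
    (hξ0 : ∀ b i l, 0 ≤ ξ b i l) (hξ1 : ∀ b i, ξ b i i = 1) (b : Fin M) (s : Fin N) :
    γ b s ≤ a b s := by
  have ha : ∀ j i, 0 ≤ a j i := fun j i => (hG.1 j i).1
  have hpos := inducingWeight_pos (hσ s) (he0 s)
  have hineq : ∀ᶠ t in 𝓝[>] (0 : ℝ), (γ b s + (boldA a s - a b s)) *
      (varianceDrop (σ s) (e s) (1 * t) / t) ≤ 1 := by
    filter_upwards [Ioo_mem_nhdsGT (sub_pos.2 (helt s))] with t ht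
    set v := varianceDrop (σ s) (e s) t with hv
    have hv0 : 0 ≤ v := varianceDrop_nonneg (hσ s) (he0 s) ht.1.le
    have hvle : boldA a s * v ≤ t := by
      rw [he]; exact inducingWeight_mul_varianceDrop_le (hσ s) (he0 s) ht.1.le
    have hδs : 0 ≤ t - (boldA a s - a b s) * v := by
      nlinarith [mul_nonneg (ha b s) hv0]
    have hT0 : ∀ i, 0 ≤ (Pi.single s t : Fin N → ℝ) i :=
      fun i => (Pi.single_nonneg.2 ht.1.le : (0 : Fin N → ℝ) ≤ Pi.single s t) i
    have hw0 : ∀ i, 0 ≤ varianceDrop (σ i) (e i) ((Pi.single s t : Fin N → ℝ) i) :=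
      fun i => varianceDrop_nonneg (hσ i) (he0 i) (hT0 i)
    have key := hG.no_gain_of_effort_raise hσ hμ hemax he0 he b (T := Pi.single s t)
      (δ := Pi.single s (t - (boldA a s - a b s) * v)) hT0
      (fun i => by
        rcases eq_or_ne i s with rfl | hi
        · rw [Pi.single_eq_same]; linarith [ht.2]
        · rw [Pi.single_eq_of_ne hi]; linarith [helt i])
      (fun i => (Pi.single_nonneg.2 hδs : (0 : Fin N → ℝ) ≤ _) i)
      (fun i => by
        rcases eq_or_ne i s with rfl | hi
        · have : ∑ j ∈ Finset.univ.erase b, a j i * v ≤ ∑ j ∈ Finset.univ.erase b,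
              a j i * ∑ l, ξ j i l *
                varianceDrop (σ l) (e l) ((Pi.single i t : Fin N → ℝ) l) := by
            refine Finset.sum_le_sum fun j _ => mul_le_mul_of_nonneg_left ?_ (ha j i)
            have := Finset.single_le_sum
              (f := fun l => ξ j i l * varianceDrop (σ l) (e l) ((Pi.single i t : Fin N → ℝ) l))
              (fun l _ => mul_nonneg (hξ0 j i l) (hw0 l)) (Finset.mem_univ i)
            simpa [hξ1] using this
          rw [← Finset.sum_mul, sum_erase_boldA] at this
          rw [Pi.single_eq_same, Pi.single_eq_same]
          linarith
        · rw [Pi.single_eq_of_ne hi, Pi.single_eq_of_ne hi, zero_add]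
          exact Finset.sum_nonneg fun j _ => mul_nonneg (ha j i)
            (Finset.sum_nonneg fun l _ => mul_nonneg (hξ0 j i l) (hw0 l)))
    rw [Finset.sum_pi_single', if_pos (Finset.mem_univ s), Finset.sum_eq_single s
      (fun i _ hi => by rw [Pi.single_eq_of_ne hi, varianceDrop_zero, mul_zero])
      (fun h => absurd (Finset.mem_univ s) h), Pi.single_eq_same] at key
    rw [one_mul, ← mul_div_assoc, div_le_one ht.1]
    linarith
  have hlim := le_of_tendsto
    ((tendsto_varianceDrop_div (hσ s) (he0 s) one_pos).const_mul _) hineq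
  rw [mul_one_div, div_le_one hpos, ← he] at hlim
  linarith

open Filter Topology in
/-- In an equilibrium with interior efforts in which all weights equal the positive demands, the
other aggregators' payments for source `i` do not depend on source `l ≠ i`. -/
theorem IsGNE.coupling_eq_zero
    (hG : IsGNE σ μ ξ γ (fun s => Set.Icc (alow (σ s)) (aubar s)) c γ)
    (hσ : ∀ s, SigmaOK (σ s))
    (hμ : ∀ s, ∀ a : ℝ, 0 < a →
      UniqueMaxOn (fun e => -a * σ s e ^ 2 - e) (Set.Icc 0 (emax s)) (μ s a))
    (hemax : ∀ s, inducingWeight (σ s) (emax s) ≤ aubar s)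
    (he0 : ∀ s, 0 ≤ e s) (he : ∀ s, boldA γ s = inducingWeight (σ s) (e s))
    (helt : ∀ s, e s < emax s)
    (hξ0 : ∀ b i l, 0 ≤ ξ b i l) (hξ1 : ∀ b i, ξ b i i = 1) (hγ : ∀ b i, 0 < γ b i)
    (b : Fin M) {i l : Fin N} (hil : i ≠ l) :
    ∑ j ∈ Finset.univ.erase b, γ j i * ξ j i l = 0 := by
  set X := ∑ j ∈ Finset.univ.erase b, γ j i * ξ j i l with hX
  have hX0 : 0 ≤ X := Finset.sum_nonneg fun j _ => mul_nonneg (hγ j i).le (hξ0 j i l)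
  have hposi : 0 < boldA γ i := he i ▸ inducingWeight_pos (hσ i) (he0 i)
  have hposl : 0 < boldA γ l := he l ▸ inducingWeight_pos (hσ l) (he0 l)
  set r := (X / boldA γ l + 1) * boldA γ i / γ b i with hr
  have hr0 : 0 < r := by have := hγ b i; positivity
  have hlimi := tendsto_varianceDrop_div (hσ i) (he0 i) hr0
  have hliml := tendsto_varianceDrop_div (hσ l) (he0 l) one_pos
  rw [← he] at hlimi hliml
  have hcmp : ∀ᶠ t in 𝓝[>] (0 : ℝ), X * (varianceDrop (σ l) (e l) (1 * t) / t) <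
      γ b i * (varianceDrop (σ i) (e i) (r * t) / t) := by
    refine (hliml.const_mul X).eventually_lt (hlimi.const_mul (γ b i)) ?_
    have : γ b i * (r / boldA γ i) = X / boldA γ l + 1 := by
      have := (hγ b i).ne'
      rw [hr]; field_simp
    rw [this, mul_one_div]
    linarith
  have hineq : ∀ᶠ t in 𝓝[>] (0 : ℝ), (boldA γ l + X) *
      (varianceDrop (σ l) (e l) (1 * t) / t) +
      boldA γ i * (varianceDrop (σ i) (e i) (r * t) / t) ≤ 1 + r := by
    filter_upwards [Ioo_mem_nhdsGT (sub_pos.2 (helt l)),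
      Ioo_mem_nhdsGT (div_pos (sub_pos.2 (helt i)) hr0), hcmp] with t htl hti htc
    have ht : 0 < t := htl.1
    have hrt : 0 < r * t := mul_pos hr0 ht
    have hrt' : r * t < emax i - e i := by
      have := (lt_div_iff₀ hr0).1 hti.2
      linarith
    rw [one_mul] at htc ⊢
    set v := varianceDrop (σ l) (e l) t with hv
    set w := varianceDrop (σ i) (e i) (r * t) with hw
    have htc' : X * v < γ b i * w := by
      rwa [← mul_div_assoc, ← mul_div_assoc, div_lt_div_iff_of_pos_right ht] at htc
    have hv0 : 0 ≤ v := varianceDrop_nonneg (hσ l) (he0 l) ht.le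
    have hw0 : 0 ≤ w := varianceDrop_nonneg (hσ i) (he0 i) hrt.le
    have hvle : boldA γ l * v ≤ t := by
      rw [he]; exact inducingWeight_mul_varianceDrop_le (hσ l) (he0 l) ht.le
    have hwle : boldA γ i * w ≤ r * t := by
      rw [he]; exact inducingWeight_mul_varianceDrop_le (hσ i) (he0 i) hrt.le
    set T : Fin N → ℝ := Pi.single i (r * t) + Pi.single l t with hT
    set δ : Fin N → ℝ := Pi.single i (r * t - (boldA γ i - γ b i) * w - X * v) +
      Pi.single l (t - (boldA γ l - γ b l) * v) with hδ
    have hTi : T i = r * t := by simp [hT, hil]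
    have hTl : T l = t := by simp [hT, hil.symm]
    have hTk : ∀ k, k ≠ i → k ≠ l → T k = 0 := fun k h₁ h₂ => by simp [hT, h₁, h₂]
    have hδi : δ i = r * t - (boldA γ i - γ b i) * w - X * v := by simp [hδ, hil]
    have hδl : δ l = t - (boldA γ l - γ b l) * v := by simp [hδ, hil.symm]
    have hδk : ∀ k, k ≠ i → k ≠ l → δ k = 0 := fun k h₁ h₂ => by simp [hδ, h₁, h₂]
    have hT0 : ∀ k, 0 ≤ T k := fun k => by
      by_cases h₁ : k = i
      · rw [h₁, hTi]; exact hrt.le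
      by_cases h₂ : k = l
      · rw [h₂, hTl]; exact ht.le
      · rw [hTk k h₁ h₂]
    have hD0 : ∀ k, 0 ≤ varianceDrop (σ k) (e k) (T k) :=
      fun k => varianceDrop_nonneg (hσ k) (he0 k) (hT0 k)
    have hpair : ∀ f : Fin N → ℝ, (∀ k, 0 ≤ f k) → f i + f l ≤ ∑ k, f k := fun f hf => by
      rw [← Finset.sum_pair hil]
      exact Finset.sum_le_sum_of_subset_of_nonneg (Finset.subset_univ _) fun k _ _ => hf k
    have key := hG.no_gain_of_effort_raise hσ hμ hemax he0 he b (T := T) (δ := δ) hT0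
      (fun k => by
        by_cases h₁ : k = i
        · rw [h₁, hTi]; linarith
        by_cases h₂ : k = l
        · rw [h₂, hTl]; linarith [htl.2]
        · rw [hTk k h₁ h₂]; linarith [helt k])
      (fun k => by
        by_cases h₁ : k = i
        · rw [h₁, hδi]; linarith
        by_cases h₂ : k = l
        · rw [h₂, hδl]; nlinarith [mul_nonneg (hγ b l).le hv0]
        · rw [hδk k h₁ h₂])
      (fun k => by
        by_cases h₁ : k = i
        · subst h₁
          have : ∑ j ∈ Finset.univ.erase b, (γ j k * w + γ j k * ξ j k l * v) ≤
              ∑ j ∈ Finset.univ.erase b,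
                γ j k * ∑ m, ξ j k m * varianceDrop (σ m) (e m) (T m) := by
            refine Finset.sum_le_sum fun j _ => ?_
            rw [mul_assoc, ← mul_add]
            refine mul_le_mul_of_nonneg_left ?_ (hγ j k).le
            have := hpair (fun m => ξ j k m * varianceDrop (σ m) (e m) (T m))
              (fun m => mul_nonneg (hξ0 j k m) (hD0 m))
            simpa only [hξ1, one_mul, hTi, hTl] using this
          rw [Finset.sum_add_distrib, ← Finset.sum_mul, ← Finset.sum_mul, sum_erase_boldA] at this
          rw [hTi, hδi]
          linarith
        by_cases h₂ : k = l
        · subst h₂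
          have : ∑ j ∈ Finset.univ.erase b, γ j k * v ≤ ∑ j ∈ Finset.univ.erase b,
              γ j k * ∑ m, ξ j k m * varianceDrop (σ m) (e m) (T m) := by
            refine Finset.sum_le_sum fun j _ => mul_le_mul_of_nonneg_left ?_ (hγ j k).le
            have := Finset.single_le_sum
              (f := fun m => ξ j k m * varianceDrop (σ m) (e m) (T m))
              (fun m _ => mul_nonneg (hξ0 j k m) (hD0 m)) (Finset.mem_univ k)
            simpa only [hξ1, one_mul, hTl] using this
          rw [← Finset.sum_mul, sum_erase_boldA] at this
          rw [hTl, hδl]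
          linarith
        · rw [hTk k h₁ h₂, hδk k h₁ h₂, zero_add]
          exact Finset.sum_nonneg fun j _ => mul_nonneg (hγ j k).le
            (Finset.sum_nonneg fun m _ => mul_nonneg (hξ0 j k m) (hD0 m)))
    have hgain := hpair (fun k => γ b k * varianceDrop (σ k) (e k) (T k))
      (fun k => mul_nonneg (hγ b k).le (hD0 k))
    have hcost : ∑ k, δ k = δ i + δ l := by
      simp [hδ, Finset.sum_add_distrib, hil, hil.symm]
    simp only [hTi, hTl] at hgain
    rw [hcost, hδi, hδl] at key
    rw [← mul_div_assoc, ← mul_div_assoc, ← add_div, div_le_iff₀ ht]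
    linarith
  have hlim := le_of_tendsto
    ((hliml.const_mul (boldA γ l + X)).add (hlimi.const_mul (boldA γ i))) hineq
  rw [mul_div_cancel₀ _ hposi.ne', mul_one_div, add_div, div_self hposl.ne'] at hlim
  have : X / boldA γ l ≤ 0 := by linarith
  exact le_antisymm (by simpa using (div_le_iff₀ hposl).1 this) hX0

end Game

/-- A minimizer of the social cost has the efforts induced by the total demands. -/
theorem eq_maximizer_of_minimizes_SC {σ μ : Fin N → ℝ → ℝ} {emax Γ e : Fin N → ℝ}
    (hμ : ∀ s, ∀ a : ℝ, 0 < a →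
      UniqueMaxOn (fun e => -a * σ s e ^ 2 - e) (Set.Icc 0 (emax s)) (μ s a))
    (hΓ : ∀ s, 0 < Γ s) (he : ∀ s, e s ∈ Set.Icc 0 (emax s))
    (hmin : ∀ e' : Fin N → ℝ, (∀ s, e' s ∈ Set.Icc 0 (emax s)) → SC Γ σ e ≤ SC Γ σ e')
    (s : Fin N) : e s = μ s (Γ s) := by
  have hle : ∀ i, Γ i * σ i (μ i (Γ i)) ^ 2 + μ i (Γ i) ≤ Γ i * σ i (e i) ^ 2 + e i :=
    fun i => by linarith [(hμ i (Γ i) (hΓ i)).2.1 (e i) (he i)]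
  have hsum := hmin (fun i => μ i (Γ i)) fun i => (hμ i (Γ i) (hΓ i)).1
  unfold SC at hsum
  rw [← Finset.sum_add_distrib, ← Finset.sum_add_distrib] at hsum
  have heq := (Finset.sum_eq_sum_iff_of_le fun i _ => hle i).1
    (le_antisymm (Finset.sum_le_sum fun i _ => hle i) hsum) s (Finset.mem_univ s)
  refine (hμ s (Γ s) (hΓ s)).2.2 (e s) (he s) fun x hx => ?_
  have := (hμ s (Γ s) (hΓ s)).2.1 x hx
  linarith

/-- Without coupling, offering the demands as weights and sharing the payments equally is an
equilibrium. -/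
theorem isGNE_of_no_coupling {σ μ : Fin N → ℝ → ℝ} {ξ : Fin M → Fin N → Fin N → ℝ}
    {γ : Fin M → Fin N → ℝ} {emax : Fin N → ℝ} {𝒜 : Fin N → Set ℝ} (hM : 0 < M)
    (hμ : ∀ s, ∀ a : ℝ, 0 < a →
      UniqueMaxOn (fun e => -a * σ s e ^ 2 - e) (Set.Icc 0 (emax s)) (μ s a))
    (h𝒜 : ∀ s, ∀ x ∈ 𝒜 s, 0 < x) (hγ : ∀ b i, 0 ≤ γ b i) (hmem : ∀ s, boldA γ s ∈ 𝒜 s)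
    (hξ1 : ∀ b i, ξ b i i = 1) (hξ : ∀ j i l, i ≠ l → ξ j i l = 0) :
    IsGNE σ μ ξ γ 𝒜 (fun j s => qb σ μ ξ γ j s + μ s (boldA γ s) / M) γ := by
  have hM' : (M : ℝ) ≠ 0 := by exact_mod_cast hM.ne'
  have hsum : ∀ b s (W : Fin N → ℝ), ∑ l, ξ b s l * W l = W s := fun b s W => by
    rw [Finset.sum_eq_single s (fun l _ hl => by rw [hξ b s l hl.symm, zero_mul])
      (fun h => absurd (Finset.mem_univ s) h), hξ1, one_mul]
  have hbest := fun s => hμ s (boldA γ s) (h𝒜 s _ (hmem s))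
  refine ⟨fun b s => ⟨hγ b s, hmem s, ?_, ?_⟩, fun b c' a' hfeas => ?_⟩
  · rw [Finset.sum_add_distrib, add_sub_cancel_left, Finset.sum_const, Finset.card_univ,
      Fintype.card_fin, nsmul_eq_mul, mul_div_cancel₀ _ hM']
  · have := (hbest s).1.1
    rw [add_sub_cancel_left]
    positivity
  · unfold Lagg
    rw [← Finset.sum_add_distrib, ← Finset.sum_add_distrib]
    refine Finset.sum_le_sum fun s _ => ?_
    obtain ⟨-, hA, hIR, -⟩ := hfeas s
    have hopt := (hbest s).2.1 _ (hμ s _ (h𝒜 s _ hA)).1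
    rw [← Finset.sum_sub_distrib, ← Finset.add_sum_erase _ _ (Finset.mem_univ b)] at hIR
    have hother : ∑ j ∈ Finset.univ.erase b,
        (Function.update (fun j s => qb σ μ ξ γ j s + μ s (boldA γ s) / M) b c' j s -
          qb σ μ ξ (Function.update γ b a') j s) =
        (boldA γ s - γ b s) * (Vval σ μ γ s - Vval σ μ (Function.update γ b a') s) +
          (M - 1) * (μ s (boldA γ s) / M) := by
      have hterm : ∀ j ∈ Finset.univ.erase b,
          Function.update (fun j s => qb σ μ ξ γ j s + μ s (boldA γ s) / M) b c' j s -
            qb σ μ ξ (Function.update γ b a') j s =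
          γ j s * (Vval σ μ γ s - Vval σ μ (Function.update γ b a') s) +
            μ s (boldA γ s) / M := fun j hj => by
        have hne := Finset.ne_of_mem_erase hj
        simp only [qb, Function.update_of_ne hne, hsum]
        ring
      rw [Finset.sum_congr rfl hterm, Finset.sum_add_distrib, ← Finset.sum_mul, sum_erase_boldA,
        Finset.sum_const, Finset.card_erase_of_mem (Finset.mem_univ b), Finset.card_univ,
        Fintype.card_fin, nsmul_eq_mul, Nat.cast_sub hM, Nat.cast_one]
    rw [hother] at hIR
    simp only [qb, hsum, Function.update_self] at hIR ⊢
    unfold Vval at hIR ⊢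
    have hshare : (M - 1) * (μ s (boldA γ s) / M) = μ s (boldA γ s) - μ s (boldA γ s) / M := by
      field_simp
    linarith

theorem stmt_18 (N M : ℕ) (hN : 1 ≤ N) (hM : 2 ≤ M)
    (σ μ : Fin N → ℝ → ℝ) (ξ : Fin M → Fin N → Fin N → ℝ) (γ : Fin M → Fin N → ℝ)
    (emax aubar : Fin N → ℝ) (hemax : ∀ s, 0 < emax s)
    (hσ : ∀ s, SigmaOK (σ s))
    (hμ : ∀ s, ∀ a : ℝ, 0 < a →
      UniqueMaxOn (fun e => -a * σ s e ^ 2 - e) (Set.Icc 0 (emax s)) (μ s a))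
    (haubar : ∀ s, IsLeast {x : ℝ | 0 < x ∧ μ s x = emax s} (aubar s))
    (hξ0 : ∀ b i l, 0 ≤ ξ b i l) (hξ1 : ∀ b i, ξ b i i = 1)
    (hγ : ∀ b i, 0 < γ b i)
    (hΓ : ∀ s, alow (σ s) ≤ (∑ j, γ j s) ∧ (∑ j, γ j s) < aubar s) :
    (∃ c a : Fin M → Fin N → ℝ,
      IsGNE σ μ ξ γ (fun s => Set.Icc (alow (σ s)) (aubar s)) c a ∧
      (∀ s, μ s (boldA a s) ∈ Set.Icc 0 (emax s)) ∧
      ∀ e : Fin N → ℝ, (∀ s, e s ∈ Set.Icc 0 (emax s)) →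
        SC (fun s => ∑ j, γ j s) σ (fun s => μ s (boldA a s)) ≤
          SC (fun s => ∑ j, γ j s) σ e) ↔
    (∀ j i l, i ≠ l → ξ j i l = 0) := by
  have hboldΓ : ∀ s, boldA γ s = ∑ j, γ j s := fun s => rfl
  have hΓpos : ∀ s, 0 < ∑ j, γ j s := fun s => (hσ s).alow_pos.trans_le (hΓ s).1
  constructor
  · rintro ⟨c, a, hG, hmem, hmin⟩ j i l hil
    have hb : Nontrivial (Fin M) := Fin.nontrivial_iff_two_le.2 hM
    set e : Fin N → ℝ := fun s => μ s (∑ j, γ j s) with he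
    have hemaxle : ∀ s, inducingWeight (σ s) (emax s) ≤ aubar s := fun s =>
      inducingWeight_le_of_maximizer_eq (hσ s) (hemax s) (hμ s) (haubar s).1.1 (haubar s).1.2
    have heff : ∀ s, μ s (boldA a s) = e s := eq_maximizer_of_minimizes_SC hμ hΓpos hmem hmin
    have he0 : ∀ s, 0 ≤ e s := fun s => (hμ s _ (hΓpos s)).1.1
    have helt : ∀ s, e s < emax s := fun s =>
      (hμ s _ (hΓpos s)).1.2.lt_of_ne fun h =>
        (hΓ s).2.not_ge ((haubar s).2 ⟨hΓpos s, h⟩)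
    have hγw : ∀ s, boldA γ s = inducingWeight (σ s) (e s) := fun s =>
      eq_inducingWeight (hσ s) (hμ s) (hΓ s).1 (helt s)
    have haw : ∀ s, boldA a s = inducingWeight (σ s) (e s) := fun s => by
      rw [← heff s]
      exact eq_inducingWeight (hσ s) (hμ s) (hG.1 j s).2.1.1 (by rw [heff s]; exact helt s)
    have hge := hG.demand_le_weight hσ hμ hemaxle he0 haw helt hξ0 hξ1
    have hγa : γ = a := by
      ext b s
      exact (Finset.sum_eq_sum_iff_of_le fun b _ => hge b s).1
        ((hγw s).trans (haw s).symm) b (Finset.mem_univ b)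
    subst hγa
    obtain ⟨b, hbj⟩ := exists_ne j
    have hzero := hG.coupling_eq_zero hσ hμ hemaxle he0 hγw helt hξ0 hξ1 hγ b hil
    have := (Finset.sum_eq_zero_iff_of_nonneg fun k _ => mul_nonneg (hγ k i).le (hξ0 k i l)).1
      hzero j (Finset.mem_erase.2 ⟨hbj.symm, Finset.mem_univ j⟩)
    exact (mul_eq_zero.1 this).resolve_left (hγ j i).ne'
  · intro hξ
    refine ⟨_, γ, isGNE_of_no_coupling (by omega) hμ
      (fun s x hx => (hσ s).alow_pos.trans_le hx.1) (fun b i => (hγ b i).le)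
      (fun s => ⟨(hΓ s).1, (hΓ s).2.le⟩) hξ1 hξ, fun s => (hμ s _ (hΓpos s)).1, fun e he => ?_⟩
    unfold SC
    rw [← Finset.sum_add_distrib, ← Finset.sum_add_distrib]
    refine Finset.sum_le_sum fun s _ => ?_
    have := (hμ s _ (hΓpos s)).2.1 (e s) (he s)
    simp only [hboldΓ]
    linarith
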